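/- Let ρ₁ ≥ ρ₂ ≥ ρ₃ > 0 and suppose X_i(ρ) > 0 for i = 1, 2, 3. Then X₁(ρ)/X₃(ρ) ≥ ρ₁/ρ₃, and consequently max over pairs (i,j) of X_i(ρ)/X_j(ρ) is at least ρ₁/ρ₃; moreover equality X₁(ρ)/X₃(ρ) = ρ₁/ρ₃ holds if and only if ρ₁ = ρ₂ = ρ₃. Explicitly, X₁(ρ)/X₃(ρ) = (ρ₁·((ρ₁+ρ₃−ρ₂)² + 4ρ₃(ρ₂−ρ₃)))/(ρ₃·((ρ₁+ρ₃−ρ₂)² − 4ρ₁(ρ₁−ρ₂))). -/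

import Mathlib

/-- The diagonal entry of the cross curvature (0,2)-tensor of the left-invariant
metric on `SU(2)` with diagonal entries `(a,b,c)` in a Milnor frame, in the direction
of the first entry; it is symmetric in `b` and `c`. -/
noncomputable def crossX (a b c : ℝ) : ℝ :=
  ((a ^ 2 + b ^ 2 - 3 * c ^ 2 - 2 * a * b + 2 * a * c + 2 * b * c) *
    (a ^ 2 - 3 * b ^ 2 + c ^ 2 + 2 * a * b - 2 * a * c + 2 * b * c)) /
    (16 * a * b ^ 2 * c ^ 2)

/-- the eigenvalue-ratio monotonicity `λ(g) ≤ λ(X(g))` for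
left-invariant metrics on `SU(2)`, algebraic core.  If `ρ₁ ≥ ρ₂ ≥ ρ₃ > 0` and all
`X_i(ρ) > 0` then `X₁/X₃` is given by the explicit formula, `X₁/X₃ ≥ ρ₁/ρ₃` (hence
the largest ratio `X_i/X_j` is at least `ρ₁/ρ₃`), with equality iff
`ρ₁ = ρ₂ = ρ₃`. -/
theorem stmt_18 (ρ₁ ρ₂ ρ₃ : ℝ) (h12 : ρ₂ ≤ ρ₁) (h23 : ρ₃ ≤ ρ₂) (h3 : 0 < ρ₃)
    (hX₁ : 0 < crossX ρ₁ ρ₂ ρ₃) (hX₂ : 0 < crossX ρ₂ ρ₁ ρ₃)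
    (hX₃ : 0 < crossX ρ₃ ρ₁ ρ₂) :
    crossX ρ₁ ρ₂ ρ₃ / crossX ρ₃ ρ₁ ρ₂
        = (ρ₁ * ((ρ₁ + ρ₃ - ρ₂) ^ 2 + 4 * ρ₃ * (ρ₂ - ρ₃))) /
          (ρ₃ * ((ρ₁ + ρ₃ - ρ₂) ^ 2 - 4 * ρ₁ * (ρ₁ - ρ₂))) ∧
    ρ₁ / ρ₃ ≤ crossX ρ₁ ρ₂ ρ₃ / crossX ρ₃ ρ₁ ρ₂ ∧
    ρ₁ / ρ₃ ≤
      max (crossX ρ₁ ρ₂ ρ₃ / crossX ρ₂ ρ₁ ρ₃)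
        (max (crossX ρ₁ ρ₂ ρ₃ / crossX ρ₃ ρ₁ ρ₂)
          (max (crossX ρ₂ ρ₁ ρ₃ / crossX ρ₁ ρ₂ ρ₃)
            (max (crossX ρ₂ ρ₁ ρ₃ / crossX ρ₃ ρ₁ ρ₂)
              (max (crossX ρ₃ ρ₁ ρ₂ / crossX ρ₁ ρ₂ ρ₃)
                (crossX ρ₃ ρ₁ ρ₂ / crossX ρ₂ ρ₁ ρ₃))))) ∧
    (crossX ρ₁ ρ₂ ρ₃ / crossX ρ₃ ρ₁ ρ₂ = ρ₁ / ρ₃ ↔ ρ₁ = ρ₂ ∧ ρ₂ = ρ₃) := by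
  have h2 : 0 < ρ₂ := lt_of_lt_of_le h3 h23
  have h1 : 0 < ρ₁ := lt_of_lt_of_le h2 h12
  obtain ⟨P, hP⟩ : ∃ P, P = (ρ₁ + ρ₃ - ρ₂) ^ 2 + 4 * ρ₃ * (ρ₂ - ρ₃) := ⟨_, rfl⟩
  obtain ⟨Q, hQ⟩ : ∃ Q, Q = (ρ₁ + ρ₃ - ρ₂) ^ 2 - 4 * ρ₁ * (ρ₁ - ρ₂) := ⟨_, rfl⟩
  obtain ⟨R, hR⟩ : ∃ R, R = ρ₁ ^ 2 - 3 * ρ₂ ^ 2 + ρ₃ ^ 2 + 2 * ρ₁ * ρ₂ - 2 * ρ₁ * ρ₃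
      + 2 * ρ₂ * ρ₃ := ⟨_, rfl⟩
  have e1 : crossX ρ₁ ρ₂ ρ₃ = P * R / (16 * ρ₁ * ρ₂ ^ 2 * ρ₃ ^ 2) := by
    rw [crossX, hP, hR]; congr 1; ring
  have e2 : crossX ρ₂ ρ₁ ρ₃ = P * Q / (16 * ρ₂ * ρ₁ ^ 2 * ρ₃ ^ 2) := by
    rw [crossX, hP, hQ]; congr 1; ring
  have e3 : crossX ρ₃ ρ₁ ρ₂ = R * Q / (16 * ρ₃ * ρ₁ ^ 2 * ρ₂ ^ 2) := by
    rw [crossX, hR, hQ]; congr 1; ring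
  have hPpos : 0 < P := by
    have ha : 0 < ρ₁ + ρ₃ - ρ₂ := by linarith
    have hb : 0 ≤ ρ₂ - ρ₃ := by linarith
    rw [hP]; positivity
  have hPR : 0 < P * R := by
    rw [e1] at hX₁
    exact (div_pos_iff_of_pos_right (by positivity)).1 hX₁
  have hPQ : 0 < P * Q := by
    rw [e2] at hX₂
    exact (div_pos_iff_of_pos_right (by positivity)).1 hX₂
  have hRpos : 0 < R := (mul_pos_iff_of_pos_left hPpos).1 hPR
  have hQpos : 0 < Q := (mul_pos_iff_of_pos_left hPpos).1 hPQ
  have hm3 : 0 ≤ ρ₃ * (ρ₂ - ρ₃) := mul_nonneg h3.le (by linarith)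
  have hm1 : 0 ≤ ρ₁ * (ρ₁ - ρ₂) := mul_nonneg h1.le (by linarith)
  have hdiff : P - Q = 4 * (ρ₃ * (ρ₂ - ρ₃)) + 4 * (ρ₁ * (ρ₁ - ρ₂)) := by
    rw [hP, hQ]; ring
  have key : crossX ρ₁ ρ₂ ρ₃ / crossX ρ₃ ρ₁ ρ₂ = (ρ₁ * P) / (ρ₃ * Q) := by
    rw [e1, e3]
    clear hP hQ hR hdiff
    field_simp
  have hle : ρ₁ / ρ₃ ≤ crossX ρ₁ ρ₂ ρ₃ / crossX ρ₃ ρ₁ ρ₂ := by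
    rw [key, mul_div_mul_comm]
    exact le_mul_of_one_le_right (by positivity) ((one_le_div hQpos).2 (by linarith))
  refine ⟨by rw [key, hP, hQ], hle, ?_, ?_⟩
  · exact le_max_of_le_right (le_max_of_le_left hle)
  · rw [key, mul_div_mul_comm]
    have hpos : ρ₁ / ρ₃ ≠ 0 := by positivity
    rw [mul_eq_left₀ hpos, div_eq_one_iff_eq hQpos.ne']
    constructor
    · intro h
      have z3 : ρ₃ * (ρ₂ - ρ₃) = 0 := by linarith
      have z1 : ρ₁ * (ρ₁ - ρ₂) = 0 := by linarith
      have y3 := (mul_eq_zero.1 z3).resolve_left h3.ne'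
      have y1 := (mul_eq_zero.1 z1).resolve_left h1.ne'
      exact ⟨by linarith, by linarith⟩
    · rintro ⟨rfl, rfl⟩
      linarith
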